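/- arXiv:2311.15049 — 2 statements merged into one kernel-verified Lean document; each statement's English description precedes it below -/
import Mathlib

section
/- Let F be an Archimedean vector lattice and f ∈ F with f ≥ 0. The order interval [0,f] is order locally pre-compact (every filter on F containing [0,f] that order converges to a point of [0,f] contains an order pre-compact subset of [0,f]) if and only if every g with 0 < g ≤ f dominates an atom of F (i.e., f belongs to the atomic part F_a of F). -/
/-- A filter `G` on a lattice order converges to `p` if it contains a family of
order intervals whose intersection equals `{p}`. -/
def OrderConvergesTo {F : Type*} [Lattice F] (G : Filter F) (p : F) : Prop :=
  ∃ S : Set (F × F),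
    (∀ q ∈ S, q.1 ≤ q.2) ∧
    (∀ q ∈ S, Set.Icc q.1 q.2 ∈ G) ∧
    (⋂ q ∈ S, Set.Icc q.1 q.2) = {p}

/-- A filter `G` is order Cauchy if the pushforward of `G ×ˢ G` under `(x, y) ↦ x - y`
order converges to `0`. -/
def OrderCauchy {F : Type*} [Lattice F] [AddCommGroup F] (G : Filter F) : Prop :=
  OrderConvergesTo (Filter.map (fun q : F × F => q.1 - q.2) (G ×ˢ G)) (0 : F)

/-- A subset `S` is order pre-compact if every ultrafilter containing `S` is order Cauchy. -/
def OrderPreCompact {F : Type*} [Lattice F] [AddCommGroup F] (S : Set F) : Prop :=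
  ∀ U : Ultrafilter F, S ∈ U → OrderCauchy (U : Filter F)

/-- An atom of a vector lattice: a positive element all of whose order-subelements are
scalar multiples of it. -/
def IsVLAtom {F : Type*} [Lattice F] [AddCommGroup F] [Module ℝ F] (a : F) : Prop :=
  0 < a ∧ ∀ b : F, 0 ≤ b → b ≤ a → ∃ t : ℝ, b = t • a

section VectorLattice

lemma OrderCauchy.exists_mem_sub_le {F : Type*} [Lattice F] [AddCommGroup F] {G : Filter F}
    (hG : OrderCauchy G) {g : F} (hg : 0 < g) :
    ∃ A ∈ G, ∃ v : F, 0 ≤ v ∧ ¬ g ≤ v ∧ ∀ x ∈ A, ∀ y ∈ A, x - y ≤ v := by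
  obtain ⟨S, -, h2, h3⟩ := hG
  have h0 : (0 : F) ∈ ⋂ q ∈ S, Set.Icc q.1 q.2 := h3 ▸ rfl
  have hgS : g ∉ ⋂ q ∈ S, Set.Icc q.1 q.2 := by rw [h3]; exact hg.ne'
  simp only [Set.mem_iInter, not_forall] at h0 hgS
  obtain ⟨q, hq, hgq⟩ := hgS
  obtain ⟨A, hA, hAq⟩ := Filter.mem_prod_self_iff.1 (Filter.mem_map.1 (h2 q hq))
  exact ⟨A, hA, q.2, (h0 q hq).2, fun h => hgq ⟨(h0 q hq).1.trans hg.le, h⟩,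
    fun x hx y hy => (hAq (Set.mk_mem_prod hx hy)).2⟩

/-- A set all of whose ultrafilters contain a member of the family `A` is covered by finitely
many members of `A`. -/
lemma exists_finset_subset_iUnion_of_ultrafilter {α ι : Type*} {I : Set α} {A : ι → Set α}
    (h : ∀ U : Ultrafilter α, I ∈ U → ∃ i, A i ∈ U) :
    ∃ t : Finset ι, I ⊆ ⋃ i ∈ t, A i := by
  obtain ⟨t, ht⟩ := (ultrafilter_isClosed_basic I).isCompact.elim_finite_subcover
    (fun i => {U : Ultrafilter α | A i ∈ U}) (fun i => ultrafilter_isOpen_basic _)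
    (fun U hU => by simpa using h U hU)
  refine ⟨t, fun x hx => ?_⟩
  have := ht (a := pure x) hx
  simpa using this

lemma inf_eq_zero_of_le {F : Type*} [Lattice F] [Zero F] {a b a' b' : F}
    (h : a ⊓ b = 0) (ha : 0 ≤ a') (hb : 0 ≤ b') (haa : a' ≤ a) (hbb : b' ≤ b) : a' ⊓ b' = 0 :=
  le_antisymm ((inf_le_inf haa hbb).trans h.le) (le_inf ha hb)

/-- If every positive element below `g` splits into two disjoint positive elements, then any
finite family of positive elements below `g` dominates a pairwise disjoint positive family. -/
lemma exists_pairwise_disjoint_le {F ι : Type*} [Lattice F] [AddCommGroup F] {g : F}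
    (hsplit : ∀ h : F, 0 < h → h ≤ g → ∃ a b : F, 0 < a ∧ 0 < b ∧ a ≤ h ∧ b ≤ h ∧ a ⊓ b = 0)
    (s : Finset ι) (w : ι → F) (hw : ∀ i ∈ s, 0 < w i) (hwg : ∀ i ∈ s, w i ≤ g) :
    ∃ h : ι → F, (∀ i ∈ s, 0 < h i ∧ h i ≤ w i) ∧
      ∀ i ∈ s, ∀ j ∈ s, i ≠ j → h i ⊓ h j = 0 := by
  classical
  induction s using Finset.induction_on with
  | empty => exact ⟨w, by simp, by simp⟩
  | insert k s hk ih =>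
    obtain ⟨h, h1, h2⟩ := ih (fun i hi => hw i (by simp [hi])) (fun i hi => hwg i (by simp [hi]))
    have hne : ∀ i ∈ s, i ≠ k := fun i hi e => hk (e ▸ hi)
    have hwk : 0 < w k := hw k (by simp)
    suffices H : ∃ (h' : ι → F) (b : F), (∀ i ∈ s, 0 < h' i ∧ h' i ≤ h i) ∧ 0 < b ∧ b ≤ w k ∧
        ∀ i ∈ s, h' i ⊓ b = 0 by
      obtain ⟨h', b, h3, hb, hbw, h4⟩ := H
      refine ⟨Function.update h' k b, ?_, ?_⟩
      · intro i hi
        rcases Finset.mem_insert.1 hi with rfl | hi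
        · simpa using ⟨hb, hbw⟩
        · rw [Function.update_of_ne (hne i hi)]
          exact ⟨(h3 i hi).1, (h3 i hi).2.trans (h1 i hi).2⟩
      · intro i hi j hj hij
        rcases Finset.mem_insert.1 hi with hik | his <;>
          rcases Finset.mem_insert.1 hj with hjk | hjs
        · exact absurd (hik.trans hjk.symm) hij
        · rw [hik, Function.update_self, Function.update_of_ne (hne j hjs), inf_comm]
          exact h4 j hjs
        · rw [hjk, Function.update_self, Function.update_of_ne (hne i his)]
          exact h4 i his
        · rw [Function.update_of_ne (hne i his), Function.update_of_ne (hne j hjs)]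
          exact inf_eq_zero_of_le (h2 i his j hjs hij) (h3 i his).1.le (h3 j hjs).1.le
            (h3 i his).2 (h3 j hjs).2
    by_cases H : ∃ i ∈ s, h i ⊓ w k ≠ 0
    · obtain ⟨i, hi, hiw⟩ := H
      obtain ⟨a, b, ha, hb, hac, hbc, hab⟩ := hsplit (h i ⊓ w k)
        (lt_of_le_of_ne (le_inf (h1 i hi).1.le hwk.le) hiw.symm)
        (inf_le_right.trans (hwg k (by simp)))
      refine ⟨Function.update h i a, b, ?_, hb, hbc.trans inf_le_right, ?_⟩
      · intro j hj
        rcases eq_or_ne j i with rfl | hji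
        · simpa using ⟨ha, hac.trans inf_le_left⟩
        · rw [Function.update_of_ne hji]
          exact ⟨(h1 j hj).1, le_rfl⟩
      · intro j hj
        rcases eq_or_ne j i with rfl | hji
        · simpa using hab
        · rw [Function.update_of_ne hji]
          exact inf_eq_zero_of_le (h2 j hj i hi hji) (h1 j hj).1.le hb.le le_rfl
            (hbc.trans inf_le_left)
    · push Not at H
      exact ⟨h, w k, fun i hi => ⟨(h1 i hi).1, le_rfl⟩, hwk, le_rfl, H⟩

variable {F : Type*} [Lattice F] [AddCommGroup F] [IsOrderedAddMonoid F]

lemma inf_add_le_inf_add_inf {a b c : F} (ha : 0 ≤ a) (hb : 0 ≤ b) (hc : 0 ≤ c) :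
    a ⊓ (b + c) ≤ a ⊓ b + a ⊓ c := by
  rw [inf_add, add_inf, add_inf]
  refine le_inf (le_inf ?_ ?_) (le_inf ?_ inf_le_right)
  · exact inf_le_left.trans (le_add_of_nonneg_left ha)
  · exact inf_le_left.trans (le_add_of_nonneg_right hc)
  · exact inf_le_left.trans (le_add_of_nonneg_left hb)

lemma inf_add_eq_zero {a b c : F} (hab : a ⊓ b = 0) (hac : a ⊓ c = 0) : a ⊓ (b + c) = 0 := by
  have ha : 0 ≤ a := hab ▸ inf_le_left
  have hb : 0 ≤ b := hab ▸ inf_le_right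
  have hc : 0 ≤ c := hac ▸ inf_le_right
  refine le_antisymm ?_ (le_inf ha (add_nonneg hb hc))
  simpa [hab, hac] using inf_add_le_inf_add_inf ha hb hc

lemma inf_sum_eq_zero {ι : Type*} {a : F} (ha : 0 ≤ a) {s : Finset ι} {b : ι → F}
    (h : ∀ i ∈ s, a ⊓ b i = 0) : a ⊓ ∑ i ∈ s, b i = 0 := by
  classical
  induction s using Finset.induction_on with
  | empty => simpa using ha
  | insert i s hi ih =>
    rw [Finset.sum_insert hi]
    exact inf_add_eq_zero (h i (by simp)) (ih fun j hj => h j (by simp [hj]))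

lemma inf_nsmul_eq_zero {a b : F} (h : a ⊓ b = 0) (n : ℕ) : a ⊓ n • b = 0 := by
  have ha : 0 ≤ a := h ▸ inf_le_left
  simpa using inf_sum_eq_zero ha (s := Finset.range n) (b := fun _ => b) fun _ _ => h

/-- In a disjoint decomposition, a bound by a disjoint summand can be dropped. -/
lemma le_of_le_add_of_inf_eq_zero {a b c : F} (hb : 0 ≤ b) (hac : a ⊓ c = 0)
    (h : a ≤ b + c) : a ≤ b := by
  have ha : 0 ≤ a := hac ▸ inf_le_left
  have hc : 0 ≤ c := hac ▸ inf_le_right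
  calc a = a ⊓ (b + c) := (inf_eq_left.2 h).symm
    _ ≤ a ⊓ b + a ⊓ c := inf_add_le_inf_add_inf ha hb hc
    _ ≤ b := by rw [hac, add_zero]; exact inf_le_right

lemma exists_not_inf_nsmul_le (harch : ∀ x y : F, (∀ n : ℕ, 0 ≤ n • x ∧ n • x ≤ y) → x = 0)
    {g v h : F} (hv : 0 ≤ v) (h0 : 0 < h) (hh : h ≤ (g - v)⁺) :
    ∃ n : ℕ, ¬ g ⊓ n • h ≤ v := by
  by_contra! H
  refine h0.ne' (harch h v fun n => ⟨nsmul_nonneg h0.le n, ?_⟩)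
  have hz : (g - v)⁺ ⊓ (n • h - v)⁺ = 0 := by
    let _ : DistribLattice F := AddCommGroup.toDistribLattice F
    rw [posPart_def, posPart_def, ← sup_inf_right, ← inf_sub]
    exact sup_eq_right.2 (sub_nonpos.2 (H n))
  have h1 : (n • h - v)⁺ ⊓ h = 0 := by
    rw [inf_comm]
    exact inf_eq_zero_of_le hz h0.le (posPart_nonneg _) hh le_rfl
  have h2 := inf_nsmul_eq_zero h1 n
  have h3 : (n • h - v)⁺ ≤ n • h := sup_le (sub_le_self _ hv) (nsmul_nonneg h0.le n)
  rw [inf_eq_left.2 h3] at h2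
  exact sub_nonpos.1 (posPart_eq_zero.1 h2)

/-- In an Archimedean vector lattice, an interval `[0, g]` below which positive elements split
is not covered by finitely many sets whose differences are bounded by elements not above `g`. -/
lemma not_finite_cover_of_splits
    (harch : ∀ x y : F, (∀ n : ℕ, 0 ≤ n • x ∧ n • x ≤ y) → x = 0) {g : F} (hg : 0 ≤ g)
    (hsplit : ∀ h : F, 0 < h → h ≤ g → ∃ a b : F, 0 < a ∧ 0 < b ∧ a ≤ h ∧ b ≤ h ∧ a ⊓ b = 0)
    {κ : Type*} [Fintype κ] (A : κ → Set F) (v : κ → F) (hv0 : ∀ k, 0 ≤ v k)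
    (hv : ∀ k, ¬ g ≤ v k) (hA : ∀ k, ∀ x ∈ A k, ∀ y ∈ A k, x - y ≤ v k)
    (hcov : Set.Icc 0 g ⊆ ⋃ k, A k) : False := by
  classical
  obtain ⟨h, h1, h2⟩ := exists_pairwise_disjoint_le hsplit
    (Finset.univ : Finset (κ × Option κ)) (fun t => (g - v t.1)⁺)
    (fun t _ => lt_of_le_of_ne (posPart_nonneg _) fun e =>
      hv t.1 (sub_nonpos.1 (posPart_eq_zero.1 e.symm)))
    (fun t _ => sup_le (sub_le_self _ (hv0 _)) hg)
  have hn : ∀ t : κ × Option κ, ∃ n : ℕ, ¬ g ⊓ n • h t ≤ v t.1 := fun t =>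
    exists_not_inf_nsmul_le harch (hv0 _) (h1 t (by simp)).1 (h1 t (by simp)).2
  choose N hN using hn
  let y : κ × Option κ → F := fun t => g ⊓ N t • h t
  have hy0 : ∀ t, 0 ≤ y t := fun t => le_inf hg (nsmul_nonneg (h1 t (by simp)).1.le _)
  have hyd : ∀ s t, s ≠ t → y s ⊓ y t = 0 := by
    intro s t hst
    refine inf_eq_zero_of_le (inf_nsmul_eq_zero (b := h t) (a := N s • h s) ?_ (N t))
      (hy0 _) (hy0 _) inf_le_right inf_le_right
    rw [inf_comm]
    exact inf_nsmul_eq_zero (h2 t (by simp) s (by simp) hst.symm) _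
  let x : Option κ → F := fun i => g ⊓ ∑ k, y (k, i)
  have hs0 : ∀ i, 0 ≤ ∑ k, y (k, i) := fun i => Finset.sum_nonneg fun k _ => hy0 _
  have hx : ∀ i, x i ∈ Set.Icc 0 g := fun i => ⟨le_inf hg (hs0 i), inf_le_left⟩
  have hxA : ∀ i, ∃ k, x i ∈ A k := fun i => by simpa using hcov (hx i)
  choose c hc using hxA
  obtain ⟨i, j, hij, hcij⟩ := Fintype.exists_ne_map_eq_of_card_lt c (by simp)
  refine hN (c i, i) (le_of_le_add_of_inf_eq_zero (c := x j) (hv0 _) ?_ ?_)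
  · refine inf_eq_zero_of_le (inf_sum_eq_zero (hy0 (c i, i)) (s := Finset.univ)
      (b := fun k => y (k, j)) fun k _ => hyd _ _ ?_) (hy0 (c i, i)) (hx j).1 le_rfl inf_le_right
    simp [hij]
  · refine le_trans ?_ (sub_le_iff_le_add.1 (hA (c i) (x i) (hc i) (x j) (hcij ▸ hc j)))
    exact le_inf inf_le_left
      (Finset.single_le_sum (f := fun k => y (k, i)) (fun k _ => hy0 _) (Finset.mem_univ (c i)))

lemma OrderPreCompact.not_splits
    (harch : ∀ x y : F, (∀ n : ℕ, 0 ≤ n • x ∧ n • x ≤ y) → x = 0) {g : F} (hg : 0 < g)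
    (hpc : OrderPreCompact (Set.Icc 0 g)) :
    ¬ ∀ h : F, 0 < h → h ≤ g → ∃ a b : F, 0 < a ∧ 0 < b ∧ a ≤ h ∧ b ≤ h ∧ a ⊓ b = 0 := by
  intro hsplit
  obtain ⟨t, ht⟩ := exists_finset_subset_iUnion_of_ultrafilter (I := Set.Icc 0 g)
    (A := fun p : {p : Set F × F // 0 ≤ p.2 ∧ ¬ g ≤ p.2 ∧
      ∀ x ∈ p.1, ∀ y ∈ p.1, x - y ≤ p.2} => p.1.1) (by
    intro U hU
    obtain ⟨A, hA, v, hv⟩ := (hpc U hU).exists_mem_sub_le hg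
    exact ⟨⟨(A, v), hv⟩, hA⟩)
  refine not_finite_cover_of_splits harch hg.le hsplit (κ := t) (fun k => k.1.1.1)
    (fun k => k.1.1.2) (fun k => k.1.2.1) (fun k => k.1.2.2.1) (fun k => k.1.2.2.2) ?_
  rwa [Set.iUnion_subtype]

variable [Module ℝ F] [IsOrderedModule ℝ F]

lemma le_of_forall_le_add_smul (harch : ∀ x y : F, (∀ n : ℕ, 0 ≤ n • x ∧ n • x ≤ y) → x = 0)
    {x y h : F} (hh : 0 ≤ h) (H : ∀ ε : ℝ, 0 < ε → x ≤ y + ε • h) : x ≤ y := by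
  refine sub_nonpos.1 (posPart_eq_zero.1 (harch _ h fun n =>
    ⟨nsmul_nonneg (posPart_nonneg _) n, ?_⟩))
  rcases Nat.eq_zero_or_pos n with rfl | hn
  · simpa using hh
  · have hn' : (0 : ℝ) < n := by exact_mod_cast hn
    have h1 : (x - y)⁺ ≤ (n : ℝ)⁻¹ • h :=
      sup_le (sub_le_iff_le_add'.2 (H _ (by positivity))) (smul_nonneg (by positivity) hh)
    rw [← Nat.cast_smul_eq_nsmul ℝ]
    calc (n : ℝ) • (x - y)⁺ ≤ (n : ℝ) • (n : ℝ)⁻¹ • h := smul_le_smul_of_nonneg_left h1 hn'.le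
      _ = h := smul_inv_smul₀ hn'.ne' h

lemma inf_smul_eq_zero {a b : F} (h : a ⊓ b = 0) {t : ℝ} (ht : 0 ≤ t) : a ⊓ t • b = 0 := by
  have ha : 0 ≤ a := h ▸ inf_le_left
  have hb : 0 ≤ b := h ▸ inf_le_right
  obtain ⟨n, hn⟩ := exists_nat_ge t
  refine inf_eq_zero_of_le (inf_nsmul_eq_zero h n) ha (smul_nonneg ht hb) le_rfl ?_
  rw [← Nat.cast_smul_eq_nsmul ℝ]
  exact smul_le_smul_of_nonneg_right hn hb

/-- The multiples of a positive element `a` below `x` have a largest one. -/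
lemma exists_isGreatest_smul_le (harch : ∀ x y : F, (∀ n : ℕ, 0 ≤ n • x ∧ n • x ≤ y) → x = 0)
    {a x : F} (ha : 0 < a) (hx : 0 ≤ x) : ∃ s : ℝ, IsGreatest {t : ℝ | t • a ≤ x} s := by
  have hne : {t : ℝ | t • a ≤ x}.Nonempty := ⟨0, by simpa using hx⟩
  have hbdd : BddAbove {t : ℝ | t • a ≤ x} := by
    by_contra H
    rw [not_bddAbove_iff] at H
    refine ha.ne' (harch a x fun n => ⟨nsmul_nonneg ha.le n, ?_⟩)
    obtain ⟨t, ht, hnt⟩ := H n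
    rw [← Nat.cast_smul_eq_nsmul ℝ]
    exact (smul_le_smul_of_nonneg_right hnt.le ha.le).trans ht
  refine ⟨sSup {t : ℝ | t • a ≤ x}, ?_, fun t ht => le_csSup hbdd ht⟩
  refine le_of_forall_le_add_smul harch ha.le fun ε hε => ?_
  obtain ⟨t, ht, hst⟩ := exists_lt_of_lt_csSup hne (sub_lt_self _ hε)
  calc sSup {t : ℝ | t • a ≤ x} • a ≤ (t + ε) • a :=
        smul_le_smul_of_nonneg_right (by linarith) ha.le
    _ ≤ x + ε • a := by rw [add_smul]; exact add_le_add_left ht _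

lemma exists_split_of_not_isVLAtom
    (harch : ∀ x y : F, (∀ n : ℕ, 0 ≤ n • x ∧ n • x ≤ y) → x = 0) {h : F} (h0 : 0 < h)
    (hna : ¬ IsVLAtom h) : ∃ a b : F, 0 < a ∧ 0 < b ∧ a ≤ h ∧ b ≤ h ∧ a ⊓ b = 0 := by
  by_contra! H
  refine hna ⟨h0, fun b hb hbh => ?_⟩
  obtain ⟨s, hs, hsg⟩ := exists_isGreatest_smul_le harch h0 hb
  have hs0 : 0 ≤ s := hsg (by simpa using hb)
  refine ⟨s, le_antisymm ?_ hs⟩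
  refine le_of_forall_le_add_smul harch h0.le fun ε hε => ?_
  rw [← add_smul]
  rcases le_total 1 (s + ε) with h1 | h1
  · exact hbh.trans (by simpa using smul_le_smul_of_nonneg_right h1 h0.le)
  by_contra hn
  have hpos : 0 < (b - (s + ε) • h)⁺ := lt_of_le_of_ne (posPart_nonneg _) fun e =>
    hn (sub_nonpos.1 (posPart_eq_zero.1 e.symm))
  have hneg : 0 < (b - (s + ε) • h)⁻ := lt_of_le_of_ne (negPart_nonneg _) fun e => by
    have h2 := hsg (sub_nonneg.1 (negPart_eq_zero.1 e.symm))
    linarith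
  have hse : 0 ≤ (s + ε) • h := smul_nonneg (by linarith) h0.le
  refine H _ _ hpos hneg (sup_le ((sub_le_self _ hse).trans hbh) h0.le) (sup_le ?_ h0.le)
    (posPart_inf_negPart_eq_zero _)
  rw [neg_sub]
  exact (sub_le_self _ hb).trans (by simpa using smul_le_smul_of_nonneg_right h1 h0.le)

lemma IsVLAtom.exists_decomposition
    (harch : ∀ x y : F, (∀ n : ℕ, 0 ≤ n • x ∧ n • x ≤ y) → x = 0) {a : F} (ha : IsVLAtom a)
    {x : F} (hx : 0 ≤ x) :
    ∃ (s : ℝ) (y : F), 0 ≤ s ∧ 0 ≤ y ∧ y ⊓ a = 0 ∧ x = s • a + y := by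
  obtain ⟨s, hs, hsg⟩ := exists_isGreatest_smul_le harch ha.1 hx
  have hy : 0 ≤ x - s • a := sub_nonneg.2 hs
  refine ⟨s, x - s • a, hsg (by simpa using hx), hy, ?_, by abel⟩
  have hinf : 0 ≤ (x - s • a) ⊓ a := le_inf hy ha.1.le
  obtain ⟨r, hr⟩ := ha.2 _ hinf inf_le_right
  have h1 : s + r ≤ s := hsg (by
    change (s + r) • a ≤ x
    rw [add_smul, ← hr, ← le_sub_iff_add_le']
    exact inf_le_left)
  refine le_antisymm ?_ hinf
  rw [hr]
  exact smul_nonpos_of_nonpos_of_nonneg (by linarith) ha.1.le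

/-- Along an ultrafilter on `[0, f]`, differences are eventually bounded by the component of `f`
disjoint from an atom `a`, up to a small multiple of `a`. -/
lemma IsVLAtom.exists_mem_sub_le
    (harch : ∀ x y : F, (∀ n : ℕ, 0 ≤ n • x ∧ n • x ≤ y) → x = 0) {a : F} (ha : IsVLAtom a)
    {f f' : F} {s : ℝ} (hs : 0 ≤ s) (hf' : 0 ≤ f') (hfa : f' ⊓ a = 0) (hf : f = s • a + f')
    (U : Ultrafilter F) (hU : Set.Icc 0 f ∈ U) {ε : ℝ} (hε : 0 < ε) :
    ∃ A ∈ U, ∀ x ∈ A, ∀ y ∈ A, x - y ≤ f' + ε • a := by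
  have hdec : ∀ x : F, ∃ (r : ℝ) (x' : F), x ∈ Set.Icc 0 f →
      0 ≤ r ∧ r ≤ s ∧ 0 ≤ x' ∧ x' ≤ f' ∧ x = r • a + x' := by
    intro x
    by_cases hx : x ∈ Set.Icc 0 f
    · obtain ⟨r, x', hr, hx', hxa, rfl⟩ := ha.exists_decomposition harch hx.1
      refine ⟨r, x', fun _ => ⟨hr, ?_, hx', ?_, rfl⟩⟩
      · have h1 : r • a ≤ s • a := by
          refine le_of_le_add_of_inf_eq_zero (c := f') (smul_nonneg hs ha.1.le) ?_
            (hf ▸ (le_add_of_nonneg_right hx').trans hx.2)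
          rw [inf_comm]
          exact inf_smul_eq_zero hfa hr
        by_contra! hlt
        have h2 : 0 ≤ -((r - s) • a) := by
          rw [sub_smul, neg_sub]
          exact sub_nonneg.2 h1
        have h3 : (r - s) • a = 0 :=
          le_antisymm (neg_nonneg.1 h2) (smul_nonneg (by linarith) ha.1.le)
        rcases smul_eq_zero.1 h3 with h4 | h4
        · linarith
        · exact ha.1.ne' h4
      · refine le_of_le_add_of_inf_eq_zero (c := s • a) hf' (inf_smul_eq_zero hxa hs) ?_
        rw [add_comm, ← hf]
        exact (le_add_of_nonneg_left (smul_nonneg hr ha.1.le)).trans hx.2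
    · exact ⟨0, 0, fun h => absurd h hx⟩
  choose c p hcp using hdec
  obtain ⟨r, -, hr⟩ := (isCompact_Icc (a := (0 : ℝ)) (b := s)).ultrafilter_le_nhds (U.map c) (by
    rw [Filter.le_principal_iff]
    refine Ultrafilter.mem_map.2 (Filter.mem_of_superset hU fun x hx => ?_)
    exact ⟨(hcp x hx).1, (hcp x hx).2.1⟩)
  have hball : c ⁻¹' Metric.ball r (ε / 2) ∈ U := hr (Metric.ball_mem_nhds r (by positivity))
  refine ⟨_, Filter.inter_mem hU hball, fun x hx y hy => ?_⟩
  obtain ⟨-, -, -, hxf, hxe⟩ := hcp x hx.1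
  obtain ⟨-, -, hy0, -, hye⟩ := hcp y hy.1
  have hx2 := abs_lt.1 (Real.dist_eq _ _ ▸ Metric.mem_ball.1 hx.2)
  have hy2 := abs_lt.1 (Real.dist_eq _ _ ▸ Metric.mem_ball.1 hy.2)
  have hle : (c x - c y) • a ≤ ε • a :=
    smul_le_smul_of_nonneg_right (by linarith [hx2.2, hy2.1]) ha.1.le
  calc x - y = (p x - p y) + (c x - c y) • a := by
        rw [sub_smul]
        nth_rewrite 1 [hxe, hye]
        abel
    _ ≤ f' + ε • a := add_le_add ((sub_le_self _ hy0).trans hxf) hle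

lemma orderPreCompact_Icc_of_atomic
    (harch : ∀ x y : F, (∀ n : ℕ, 0 ≤ n • x ∧ n • x ≤ y) → x = 0) {f : F} (hf : 0 ≤ f)
    (hat : ∀ g : F, 0 < g → g ≤ f → ∃ a : F, IsVLAtom a ∧ a ≤ g) :
    OrderPreCompact (Set.Icc 0 f) := by
  intro U hU
  let D : Filter F := Filter.map (fun q : F × F => q.1 - q.2) ((U : Filter F) ×ˢ (U : Filter F))
  have hD : ∀ v : F, (∃ A ∈ U, ∀ x ∈ A, ∀ y ∈ A, x - y ≤ v) → Set.Icc (-v) v ∈ D := by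
    rintro v ⟨A, hA, hAv⟩
    refine Filter.mem_map.2 (Filter.mem_of_superset (Filter.prod_mem_prod hA hA) ?_)
    rintro ⟨x, y⟩ ⟨hx, hy⟩
    exact ⟨neg_le.1 ((neg_sub x y).trans_le (hAv y hy x hx)), hAv x hx y hy⟩
  refine ⟨{q | ∃ v : F, 0 ≤ v ∧ Set.Icc (-v) v ∈ D ∧ q = (-v, v)}, ?_, ?_, ?_⟩
  · rintro _ ⟨v, hv, -, rfl⟩
    exact (neg_nonpos.2 hv).trans hv
  · rintro _ ⟨v, -, hv, rfl⟩
    exact hv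
  · refine Set.Subset.antisymm (fun w hw => ?_) ?_
    · have hbound : ∀ v : F, 0 ≤ v → (∃ A ∈ U, ∀ x ∈ A, ∀ y ∈ A, x - y ≤ v) → |w| ≤ v := by
        intro v hv hA
        have h1 : w ∈ Set.Icc (-v) v := Set.mem_iInter₂.1 hw (-v, v) ⟨v, hv, hD v hA, rfl⟩
        exact abs_le'.2 ⟨h1.2, neg_le.1 h1.1⟩
      have hwf : |w| ≤ f :=
        hbound f hf ⟨_, hU, fun x hx y hy => (sub_le_self _ hy.1).trans hx.2⟩
      by_contra hw0
      have hwpos : 0 < |w| := lt_of_le_of_ne (abs_nonneg w) fun e => hw0 <| by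
        have h1 := le_abs_self w
        have h2 := neg_le_abs w
        rw [← e] at h1 h2
        exact le_antisymm h1 (neg_nonpos.1 h2)
      obtain ⟨a, ha, haw⟩ := hat _ hwpos hwf
      obtain ⟨s, f', hs, hf', hfa, hfe⟩ := ha.exists_decomposition harch hf
      have hwf' : |w| ≤ f' := le_of_forall_le_add_smul harch ha.1.le fun ε hε =>
        hbound _ (add_nonneg hf' (smul_nonneg hε.le ha.1.le))
          (ha.exists_mem_sub_le harch hs hf' hfa hfe U hU hε)
      rw [inf_eq_right.2 (haw.trans hwf')] at hfa
      exact ha.1.ne' hfa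
    · rintro _ rfl
      refine Set.mem_iInter₂.2 ?_
      rintro _ ⟨v, hv, -, rfl⟩
      exact ⟨neg_nonpos.2 hv, hv⟩

/-- The filter generated by the intervals `[0, g / (n + 1)]`. -/
def shrinkingIntervals (g : F) : Filter F :=
  ⨅ n : ℕ, Filter.principal (Set.Icc 0 (((n : ℝ) + 1)⁻¹ • g))

lemma mem_shrinkingIntervals {g : F} (hg : 0 ≤ g) {s : Set F} :
    s ∈ shrinkingIntervals g ↔ ∃ n : ℕ, Set.Icc 0 (((n : ℝ) + 1)⁻¹ • g) ⊆ s := by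
  rw [shrinkingIntervals, Filter.mem_iInf_of_directed]
  · simp
  · refine directed_of_isDirected_le fun m n hmn => Filter.principal_mono.2
      (Set.Icc_subset_Icc_right (smul_le_smul_of_nonneg_right ?_ hg))
    have : (m : ℝ) ≤ n := by exact_mod_cast hmn
    gcongr

lemma orderConvergesTo_shrinkingIntervals
    (harch : ∀ x y : F, (∀ n : ℕ, 0 ≤ n • x ∧ n • x ≤ y) → x = 0) {g : F} (hg : 0 ≤ g) :
    OrderConvergesTo (shrinkingIntervals g) 0 := by
  have hpos : ∀ n : ℕ, 0 ≤ ((n : ℝ) + 1)⁻¹ • g := fun n => smul_nonneg (by positivity) hg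
  refine ⟨Set.range fun n : ℕ => (0, ((n : ℝ) + 1)⁻¹ • g), ?_, ?_, ?_⟩
  · rintro _ ⟨n, rfl⟩
    exact hpos n
  · rintro _ ⟨n, rfl⟩
    exact (mem_shrinkingIntervals hg).2 ⟨n, subset_rfl⟩
  · ext w
    simp only [Set.mem_iInter, Set.forall_mem_range, Set.mem_singleton_iff, Set.mem_Icc]
    refine ⟨fun h => le_antisymm (le_of_forall_le_add_smul harch hg fun ε hε => ?_) (h 0).1, ?_⟩
    · obtain ⟨n, hn⟩ := exists_nat_one_div_lt hε
      rw [one_div] at hn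
      rw [zero_add]
      exact (h n).2.trans (smul_le_smul_of_nonneg_right hn.le hg)
    · rintro rfl n
      exact ⟨le_rfl, hpos n⟩

end VectorLattice

/-- In an Archimedean vector lattice, for `0 ≤ f` the order interval
`[0, f]` is order locally pre-compact iff every `g` with `0 < g ≤ f` dominates an atom. -/
theorem interval_orderLocallyPreCompact_iff_atomicPart
    {F : Type*} [Lattice F] [AddCommGroup F] [Module ℝ F]
    (hadd : ∀ x y z : F, x ≤ y → x + z ≤ y + z)
    (hsmul : ∀ (t : ℝ) (x : F), 0 ≤ t → 0 ≤ x → 0 ≤ t • x)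
    (harch : ∀ x y : F, (∀ n : ℕ, 0 ≤ n • x ∧ n • x ≤ y) → x = 0)
    (f : F) (hf : 0 ≤ f) :
    (∀ G : Filter F, Set.Icc (0 : F) f ∈ G →
      ∀ p ∈ Set.Icc (0 : F) f, OrderConvergesTo G p →
        ∃ S ∈ G, S ⊆ Set.Icc (0 : F) f ∧ OrderPreCompact S) ↔
      (∀ g : F, 0 < g → g ≤ f → ∃ a : F, IsVLAtom a ∧ a ≤ g) := by
  have _ : IsOrderedAddMonoid F := { add_le_add_left := fun x y h z => hadd x y z h }
  have _ : IsOrderedModule ℝ F := .of_smul_nonneg fun t ht x hx => hsmul t x ht hx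
  refine ⟨fun H g hg hgf => ?_, fun hat G hG p _ _ =>
    ⟨_, hG, subset_rfl, orderPreCompact_Icc_of_atomic harch hf hat⟩⟩
  by_contra! hna
  obtain ⟨S, hS, -, hpc⟩ := H (shrinkingIntervals g)
    ((mem_shrinkingIntervals hg.le).2 ⟨0, Set.Icc_subset_Icc_right (by simpa using hgf)⟩)
    0 ⟨le_rfl, hf⟩ (orderConvergesTo_shrinkingIntervals harch hg.le)
  obtain ⟨n, hn⟩ := (mem_shrinkingIntervals hg.le).1 hS
  have hpos : 0 < ((n : ℝ) + 1)⁻¹ • g := lt_of_le_of_ne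
    (smul_nonneg (by positivity) hg.le) (smul_ne_zero (by positivity) hg.ne').symm
  have hle : ((n : ℝ) + 1)⁻¹ • g ≤ g :=
    smul_le_of_le_one_left hg.le (inv_le_one_of_one_le₀ (by linarith [n.cast_nonneg (α := ℝ)]))
  have hpc' : OrderPreCompact (Set.Icc 0 (((n : ℝ) + 1)⁻¹ • g)) := fun U hU =>
    hpc U (Filter.mem_of_superset hU hn)
  exact hpc'.not_splits harch hpos fun h h0 hh =>
    exists_split_of_not_isVLAtom harch h0 fun hat => hna h hat (hh.trans hle)
end

section
/- For an Archimedean vector lattice F, the following are equivalent: (i) F is atomic (every g > 0 dominates an atom); (ii) every order interval [u,v] in F is order pre-compact (every ultrafilter on F containing [u,v] is order Cauchy); (iii) for every order interval [u,v], order convergence on [u,v] is topological, i.e., there is a topology τ on [u,v] such that for every filter G on F containing [u,v] and every p ∈ [u,v], G order converges to p if and only if the trace of G on [u,v] contains the τ-neighborhood filter of p. -/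
lemma inf_eq_zero_of_le_s13 {F : Type*} [Lattice F] [Zero F] {x y x' y' : F}
    (hx' : 0 ≤ x') (hy' : 0 ≤ y') (hx : x' ≤ x) (hy : y' ≤ y)
    (h : x ⊓ y = 0) : x' ⊓ y' = 0 :=
  le_antisymm ((inf_le_inf hx hy).trans h.le) (le_inf hx' hy')

lemma nonpos_of_smul_nonpos {F : Type*} [Lattice F] [AddCommGroup F] [Module ℝ F]
    [IsOrderedModule ℝ F] {a : F} (ha : 0 < a) {t : ℝ} (h : t • a ≤ 0) : t ≤ 0 := by
  by_contra! ht
  have : a = t⁻¹ • (t • a) := by rw [smul_smul, inv_mul_cancel₀ ht.ne', one_smul]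
  have h2 : t⁻¹ • (t • a) ≤ 0 := smul_nonpos_of_nonneg_of_nonpos (inv_nonneg.2 ht.le) h
  exact absurd (this.trans_le h2) ha.not_ge

section LatticeGroup

variable {F : Type*} [Lattice F] [AddCommGroup F] [IsOrderedAddMonoid F]

lemma add_inf_eq_zero_of_nonneg {x y a : F} (hx : 0 ≤ x) (hy : 0 ≤ y) (ha : 0 ≤ a)
    (hxa : x ⊓ a = 0) (hya : y ⊓ a = 0) : (x + y) ⊓ a = 0 := by
  refine le_antisymm ?_ (le_inf (add_nonneg hx hy) ha)
  set z := (x + y) ⊓ a with hz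
  have h1 : z - y ≤ 0 := by
    rw [← hxa]
    refine le_inf (sub_le_iff_le_add.2 inf_le_left) ?_
    exact (sub_le_self _ hy).trans inf_le_right
  rw [← hya]
  exact le_inf (sub_nonpos.1 h1) inf_le_right

lemma nsmul_inf_eq_zero {x a : F} (hx : 0 ≤ x) (ha : 0 ≤ a) (h : x ⊓ a = 0) (n : ℕ) :
    (n • x) ⊓ a = 0 := by
  induction n with
  | zero => simpa using ha
  | succ n ih =>
    rw [succ_nsmul]
    exact add_inf_eq_zero_of_nonneg (nsmul_nonneg hx n) hx ha ih h

lemma sum_inf_eq_zero {ι : Type*} (s : Finset ι) (D : ι → F) {a : F} (ha : 0 ≤ a)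
    (hD : ∀ i ∈ s, 0 ≤ D i) (h : ∀ i ∈ s, D i ⊓ a = 0) : (∑ i ∈ s, D i) ⊓ a = 0 := by
  classical
  induction s using Finset.induction_on with
  | empty => simpa using ha
  | insert i s hi ih =>
    rw [Finset.sum_insert hi]
    simp only [Finset.mem_insert, forall_eq_or_imp] at hD h
    exact add_inf_eq_zero_of_nonneg hD.1 (Finset.sum_nonneg hD.2) ha h.1 (ih hD.2 h.2)

lemma add_le_of_inf_eq_zero {x y h : F} (hxy : x ⊓ y = 0) (hx : x ≤ h) (hy : y ≤ h) :
    x + y ≤ h := by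
  rw [← inf_add_sup, hxy, zero_add]
  exact sup_le hx hy

lemma sub_sup_zero_inf_sub_sup_zero (x y : F) : ((x - y) ⊔ 0) ⊓ ((y - x) ⊔ 0) = 0 := by
  have := posPart_inf_negPart_eq_zero (x - y)
  rwa [posPart_def, negPart_def, neg_sub] at this

lemma sub_inf_self_eq (g D : F) : g - g ⊓ D = (g - D) ⊔ 0 := by
  rw [sub_inf, sub_self, sup_comm]

lemma sub_inf_inf_sub_sup_zero {g D D' : F} (hD : D ≤ D') :
    (g - g ⊓ D') ⊓ ((D - g) ⊔ 0) = 0 := by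
  rw [sub_inf_self_eq]
  exact inf_eq_zero_of_le_s13 le_sup_right le_sup_right
    (sup_le_sup_right (sub_le_sub_left hD g) 0) le_rfl (sub_sup_zero_inf_sub_sup_zero g D)

lemma sup_zero_pos_of_not_le {x y : F} (h : ¬ x ≤ y) : 0 < (x - y) ⊔ 0 :=
  lt_of_le_of_ne le_sup_right fun h0 => h (sub_nonpos.1 (le_sup_left.trans h0.symm.le))

lemma exists_nsmul_sub_sup_zero_pos
    (harch : ∀ x y : F, (∀ n : ℕ, 0 ≤ n • x ∧ n • x ≤ y) → x = 0) {d : F} (hd : 0 < d) (g : F) :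
    ∃ n : ℕ, 0 < (n • d - g) ⊔ 0 := by
  by_contra! h
  refine hd.ne' (harch d g fun n => ⟨nsmul_nonneg hd.le n, ?_⟩)
  by_contra hn
  exact h n (sup_zero_pos_of_not_le hn)

lemma inf_nsmul_sub_sup_zero_ne_zero {d f g : F} {n : ℕ} (hd : 0 ≤ d) (hdf : d ≤ f) (hg : 0 ≤ g)
    (hn : 0 < (n • d - g) ⊔ 0) : f ⊓ ((n • d - g) ⊔ 0) ≠ 0 := by
  intro h
  set e := (n • d - g) ⊔ 0 with he
  have h1 : d ⊓ e = 0 := inf_eq_zero_of_le_s13 hd hn.le hdf le_rfl h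
  have h2 := nsmul_inf_eq_zero hd hn.le h1 n
  have h3 : e ≤ n • d := sup_le (sub_le_self _ hg) (nsmul_nonneg hd n)
  rw [inf_eq_right.2 h3] at h2
  exact hn.ne' h2

/-- A disjoint sequence bounded above by `g` order converges to `0`. -/
lemma orderConvergesTo_zero_of_disjoint_seq
    (harch : ∀ x y : F, (∀ n : ℕ, 0 ≤ n • x ∧ n • x ≤ y) → x = 0) {g : F} {x : ℕ → F}
    (hx : ∀ n, 0 ≤ x n ∧ x n ≤ g) (hdis : ∀ m n, m < n → x m ⊓ x n = 0) :
    OrderConvergesTo (Filter.map x Filter.atTop) (0 : F) := by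
  have hg : 0 ≤ g := (hx 0).1.trans (hx 0).2
  refine ⟨{q | q.1 = 0 ∧ ∃ N, ∀ n, N ≤ n → x n ≤ q.2}, ?_, ?_, ?_⟩
  · rintro ⟨a, h⟩ ⟨rfl, N, hN⟩
    exact (hx N).1.trans (hN N le_rfl)
  · rintro ⟨a, h⟩ ⟨rfl, N, hN⟩
    exact Filter.mem_map.2 ((Filter.eventually_ge_atTop N).mono fun n hn => ⟨(hx n).1, hN n hn⟩)
  · ext z
    simp only [Set.mem_iInter, Set.mem_singleton_iff]
    constructor
    · intro hz
      have hz0 : 0 ≤ z := (hz (0, g) ⟨rfl, 0, fun n _ => (hx n).2⟩).1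
      have hle : ∀ (h : F) (N : ℕ), (∀ n, N ≤ n → x n ≤ h) → z ≤ h := fun h N hN =>
        (hz (0, h) ⟨rfl, N, hN⟩).2
      have hdz : ∀ n, z ⊓ x n = 0 := by
        intro n
        by_contra hne
        have hpos : 0 < z ⊓ x n := lt_of_le_of_ne (le_inf hz0 (hx n).1) (Ne.symm hne)
        obtain ⟨k, hk⟩ := exists_nsmul_sub_sup_zero_pos harch hpos g
        refine inf_nsmul_sub_sup_zero_ne_zero hpos.le (inf_le_left : z ⊓ x n ≤ z) hg hk ?_
        have hzk : z ≤ g - g ⊓ (k • x n) := by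
          refine hle _ (n + 1) fun m hm => ?_
          rw [le_sub_iff_add_le]
          refine add_le_of_inf_eq_zero ?_ (hx m).2 inf_le_left
          have := nsmul_inf_eq_zero (hx n).1 (hx m).1 (hdis n m hm) k
          rw [inf_comm] at this
          exact inf_eq_zero_of_le_s13 (hx m).1 (le_inf hg (nsmul_nonneg (hx n).1 k)) le_rfl
            inf_le_right this
        exact inf_eq_zero_of_le_s13 hz0 hk.le hzk le_rfl
          (sub_inf_inf_sub_sup_zero (nsmul_le_nsmul_right inf_le_right k))
      have hkz : ∀ (k : ℕ) (h : F), (∀ n, x n ≤ h) → k • z ≤ h := by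
        intro k
        induction k with
        | zero => intro h hh; simpa using (hx 0).1.trans (hh 0)
        | succ k ih =>
          intro h hh
          rw [succ_nsmul, ← le_sub_iff_add_le]
          refine ih _ fun n => ?_
          rw [le_sub_iff_add_le]
          refine add_le_of_inf_eq_zero ?_ (hh n) (hle h 0 fun n _ => hh n)
          rw [inf_comm, hdz]
      exact harch z g fun k => ⟨nsmul_nonneg hz0 k, hkz k g fun n => (hx n).2⟩
    · rintro rfl ⟨a, h⟩ ⟨rfl, N, hN⟩
      exact ⟨le_rfl, (hx N).1.trans (hN N le_rfl)⟩

end LatticeGroup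

section VectorLattice

variable {F : Type*} [Lattice F] [AddCommGroup F] [Module ℝ F] [IsOrderedAddMonoid F]
  [IsOrderedModule ℝ F]

lemma nonpos_of_forall_le_smul
    (harch : ∀ x y : F, (∀ n : ℕ, 0 ≤ n • x ∧ n • x ≤ y) → x = 0) {y b : F} (hb : 0 ≤ b)
    (h : ∀ ε : ℝ, 0 < ε → y ≤ ε • b) : y ≤ 0 := by
  have : y ⊔ 0 = 0 := by
    refine harch _ b fun n => ⟨nsmul_nonneg le_sup_right n, ?_⟩
    rcases Nat.eq_zero_or_pos n with rfl | hn
    · simpa using hb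
    have hn' : (0 : ℝ) < n := by exact_mod_cast hn
    have h1 : y ⊔ 0 ≤ (n : ℝ)⁻¹ • b :=
      sup_le (h _ (inv_pos.2 hn')) (smul_nonneg (inv_pos.2 hn').le hb)
    calc n • (y ⊔ 0) = (n : ℝ) • (y ⊔ 0) := (Nat.cast_smul_eq_nsmul ℝ n _).symm
      _ ≤ (n : ℝ) • ((n : ℝ)⁻¹ • b) := smul_le_smul_of_nonneg_left h1 hn'.le
      _ = b := by rw [smul_smul, mul_inv_cancel₀ hn'.ne', one_smul]
  exact le_sup_left.trans this.le

lemma exists_max_smul_le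
    (harch : ∀ x y : F, (∀ n : ℕ, 0 ≤ n • x ∧ n • x ≤ y) → x = 0) {f b : F} (hf : 0 < f)
    (hb : 0 ≤ b) : ∃ s : ℝ, 0 ≤ s ∧ s • f ≤ b ∧ ∀ t : ℝ, t • f ≤ b → t ≤ s := by
  set T : Set ℝ := {t | t • f ≤ b} with hT
  have h0 : (0 : ℝ) ∈ T := by simpa [hT] using hb
  have hbdd : BddAbove T := by
    by_contra hn
    refine hf.ne' (harch f b fun n => ⟨nsmul_nonneg hf.le n, ?_⟩)
    obtain ⟨t, ht, hnt⟩ := not_bddAbove_iff.1 hn n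
    rw [← Nat.cast_smul_eq_nsmul ℝ]
    exact (smul_le_smul_of_nonneg_right hnt.le hf.le).trans ht
  refine ⟨sSup T, le_csSup hbdd h0, ?_, fun t ht => le_csSup hbdd ht⟩
  rw [← sub_nonpos]
  refine nonpos_of_forall_le_smul harch hf.le fun ε hε => ?_
  obtain ⟨t, ht, hst⟩ := exists_lt_of_lt_csSup ⟨0, h0⟩ (sub_lt_self (sSup T) hε)
  rw [sub_le_iff_le_add]
  calc sSup T • f ≤ (ε + t) • f := smul_le_smul_of_nonneg_right (by linarith) hf.le
    _ = ε • f + t • f := add_smul _ _ _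
    _ ≤ ε • f + b := by gcongr; exact ht

/-- In an Archimedean vector lattice, a positive element dominating no atom dominates two
disjoint positive elements. -/
lemma exists_disjoint_of_forall_not_isVLAtom
    (harch : ∀ x y : F, (∀ n : ℕ, 0 ≤ n • x ∧ n • x ≤ y) → x = 0) {f : F} (hf : 0 < f)
    (h : ∀ a : F, a ≤ f → ¬ IsVLAtom a) :
    ∃ p q : F, 0 < p ∧ 0 < q ∧ p ≤ f ∧ q ≤ f ∧ p ⊓ q = 0 := by
  have h1 := h f le_rfl
  simp only [IsVLAtom, hf, true_and, not_forall, not_exists] at h1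
  obtain ⟨b, hb0, hbf, hb⟩ := h1
  obtain ⟨s, hs0, hsb, hs⟩ := exists_max_smul_le harch hf hb0
  by_contra hcon
  refine hb s (le_antisymm ?_ hsb)
  rw [← sub_nonpos]
  refine nonpos_of_forall_le_smul harch hf.le fun ε hε => ?_
  rw [sub_le_iff_le_add, ← add_smul]
  by_cases ht1 : 1 ≤ ε + s
  · calc b ≤ (1 : ℝ) • f := by simpa using hbf
      _ ≤ _ := smul_le_smul_of_nonneg_right ht1 hf.le
  by_contra hbt
  have htb : ¬ (ε + s) • f ≤ b := fun h' => by linarith [hs _ h']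
  refine hcon ⟨_, _, sup_zero_pos_of_not_le hbt, sup_zero_pos_of_not_le htb, ?_, ?_,
    sub_sup_zero_inf_sub_sup_zero _ _⟩
  · exact sup_le ((sub_le_self _ (smul_nonneg (by linarith) hf.le)).trans hbf) hf.le
  · refine sup_le ((sub_le_self _ hb0).trans ?_) hf.le
    calc (ε + s) • f ≤ (1 : ℝ) • f := smul_le_smul_of_nonneg_right (not_le.1 ht1).le hf.le
      _ = f := one_smul _ _

lemma exists_pairwise_disjoint_le_s13
    (harch : ∀ x y : F, (∀ n : ℕ, 0 ≤ n • x ∧ n • x ≤ y) → x = 0) {g : F}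
    (hg : ∀ a : F, a ≤ g → ¬ IsVLAtom a) {ι : Type*} (s : Finset ι) (f : ι → F)
    (hf : ∀ i ∈ s, 0 < f i ∧ f i ≤ g) :
    ∃ d : ι → F, (∀ i ∈ s, 0 < d i ∧ d i ≤ f i) ∧
      ∀ i ∈ s, ∀ j ∈ s, i ≠ j → d i ⊓ d j = 0 := by
  classical
  induction s using Finset.induction_on with
  | empty => exact ⟨fun _ => 0, by simp, by simp⟩
  | insert k s hk ih =>
    simp only [Finset.mem_insert, forall_eq_or_imp] at hf
    obtain ⟨d, hd, hdd⟩ := ih hf.2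
    by_cases hdis : ∀ i ∈ s, d i ⊓ f k = 0
    · refine ⟨Function.update d k (f k), ?_, ?_⟩
      · intro i hi
        rcases Finset.mem_insert.1 hi with rfl | hi
        · simpa using hf.1.1
        · have : i ≠ k := fun h => hk (h ▸ hi)
          simpa [this] using hd i hi
      · intro i hi j hj hij
        rcases Finset.mem_insert.1 hi with rfl | hi' <;>
          rcases Finset.mem_insert.1 hj with rfl | hj'
        · exact absurd rfl hij
        · simpa [hij.symm, inf_comm] using hdis j hj'
        · simpa [hij] using hdis i hi'
        · have h1 : i ≠ k := fun h => hk (h ▸ hi')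
          have h2 : j ≠ k := fun h => hk (h ▸ hj')
          simpa [h1, h2] using hdd i hi' j hj' hij
    · push Not at hdis
      obtain ⟨l, hl, hlk⟩ := hdis
      have hpos : 0 < d l ⊓ f k :=
        lt_of_le_of_ne (le_inf (hd l hl).1.le hf.1.1.le) hlk.symm
      obtain ⟨p, q, hp, hq, hpl, hql, hpq⟩ := exists_disjoint_of_forall_not_isVLAtom harch hpos
        fun a ha => hg a (ha.trans (inf_le_right.trans hf.1.2))
      have hlk' : l ≠ k := fun h => hk (h ▸ hl)
      set e := Function.update (Function.update d l p) k q with he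
      have hek : e k = q := by simp [he]
      have hel : e l = p := by simp [he, hlk']
      have heo : ∀ i ∈ s, i ≠ l → e i = d i := fun i hi hil => by
        have : i ≠ k := fun h => hk (h ▸ hi)
        simp [he, this, hil]
      have hes : ∀ i ∈ s, 0 < e i ∧ e i ≤ d i := fun i hi => by
        by_cases hil : i = l
        · subst hil; rw [hel]; exact ⟨hp, hpl.trans inf_le_left⟩
        · rw [heo i hi hil]; exact ⟨(hd i hi).1, le_rfl⟩
      have hks : ∀ i ∈ s, e i ⊓ e k = 0 := fun i hi => by
        by_cases hil : i = l
        · subst hil; rw [hel, hek, hpq]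
        · rw [hek]
          exact inf_eq_zero_of_le_s13 (hes i hi).1.le hq.le (hes i hi).2 (hql.trans inf_le_left)
            (hdd i hi l hl hil)
      refine ⟨e, ?_, ?_⟩
      · intro i hi
        rcases Finset.mem_insert.1 hi with rfl | hi
        · rw [hek]; exact ⟨hq, hql.trans inf_le_right⟩
        · exact ⟨(hes i hi).1, (hes i hi).2.trans (hd i hi).2⟩
      · intro i hi j hj hij
        rcases Finset.mem_insert.1 hi with rfl | hi' <;>
          rcases Finset.mem_insert.1 hj with rfl | hj'
        · exact absurd rfl hij
        · rw [inf_comm]; exact hks j hj'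
        · exact hks i hi'
        · exact inf_eq_zero_of_le_s13 (hes i hi').1.le (hes j hj').1.le (hes i hi').2 (hes j hj').2
            (hdd i hi' j hj' hij)

/-- Below a positive element dominating no atom there is an infinite sequence of disjoint
positive elements. -/
lemma exists_disjoint_seq_le
    (harch : ∀ x y : F, (∀ n : ℕ, 0 ≤ n • x ∧ n • x ≤ y) → x = 0) {f : F} (hf : 0 < f)
    (hna : ∀ a : F, a ≤ f → ¬ IsVLAtom a) :
    ∃ d : ℕ → F, (∀ n, 0 < d n ∧ d n ≤ f) ∧ ∀ m n, m < n → d m ⊓ d n = 0 := by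
  have hsplit : ∀ r : {r : F // 0 < r ∧ r ≤ f}, ∃ p : F, ∃ q : {r : F // 0 < r ∧ r ≤ f},
      0 < p ∧ p ≤ r.1 ∧ q.1 ≤ r.1 ∧ p ⊓ q.1 = 0 := fun r => by
    obtain ⟨p, q, hp, hq, hpr, hqr, hpq⟩ := exists_disjoint_of_forall_not_isVLAtom harch r.2.1
      fun a ha => hna a (ha.trans r.2.2)
    exact ⟨p, ⟨q, hq, hqr.trans r.2.2⟩, hp, hpr, hqr, hpq⟩
  choose P Q hP hPr hQr hPQ using hsplit
  set r : ℕ → {r : F // 0 < r ∧ r ≤ f} := fun n => Q^[n] ⟨f, hf, le_rfl⟩ with hr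
  have hsucc : ∀ n, r (n + 1) = Q (r n) := fun n => Function.iterate_succ_apply' _ _ _
  have hanti : Antitone fun n => (r n).1 := antitone_nat_of_succ_le fun n => by
    simp only [hsucc]; exact hQr _
  refine ⟨fun n => P (r n), fun n => ⟨hP _, (hPr _).trans (r n).2.2⟩, fun m n hmn => ?_⟩
  refine inf_eq_zero_of_le_s13 (hP _).le (hP _).le le_rfl ?_ (hPQ (r m))
  rw [← hsucc]
  exact (hPr _).trans (hanti hmn)

end VectorLattice

section AtomCoordinate

variable {F : Type*} [Lattice F] [AddCommGroup F] [Module ℝ F]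

/-- `φ` is the coordinate functional of the atom `a`. -/
structure IsAtomCoordinate (a : F) (φ : F →+ ℝ) : Prop where
  map_smul_self : ∀ r : ℝ, φ (r • a) = r
  map_nonneg : ∀ x, 0 ≤ x → 0 ≤ φ x
  smul_le : ∀ x, 0 ≤ x → φ x • a ≤ x

namespace IsAtomCoordinate

variable {a : F} {φ : F →+ ℝ}

lemma map_self (h : IsAtomCoordinate a φ) : φ a = 1 := by
  simpa using h.map_smul_self 1

lemma map_sub_smul_add (h : IsAtomCoordinate a φ) (y : F) (t : ℝ) :
    φ (y - φ y • a + t • a) = t := by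
  rw [map_add, map_sub, h.map_smul_self, h.map_smul_self]
  ring

variable [IsOrderedAddMonoid F]

lemma mono (h : IsAtomCoordinate a φ) {x y : F} (hxy : x ≤ y) : φ x ≤ φ y := by
  have := h.map_nonneg _ (sub_nonneg.2 hxy)
  rwa [map_sub, sub_nonneg] at this

lemma sub_smul_mono (h : IsAtomCoordinate a φ) {x y : F} (hxy : x ≤ y) :
    x - φ x • a ≤ y - φ y • a := by
  have := h.smul_le _ (sub_nonneg.2 hxy)
  rw [map_sub, sub_smul] at this
  rw [← sub_nonneg] at this ⊢
  convert this using 1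
  abel

variable [IsOrderedModule ℝ F]

lemma le_add_smul (h : IsAtomCoordinate a φ) (ha : 0 ≤ a) {x y : F} {t : ℝ} (hxy : x ≤ y)
    (ht : φ x ≤ t) : x ≤ y - φ y • a + t • a := by
  rw [← sub_le_iff_le_add]
  exact (sub_le_sub_left (smul_le_smul_of_nonneg_right ht ha) x).trans (h.sub_smul_mono hxy)

lemma add_smul_le (h : IsAtomCoordinate a φ) (ha : 0 ≤ a) {x y : F} {t : ℝ} (hxy : y ≤ x)
    (ht : t ≤ φ x) : y - φ y • a + t • a ≤ x := by
  rw [← le_sub_iff_add_le]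
  exact (h.sub_smul_mono hxy).trans (sub_le_sub_left (smul_le_smul_of_nonneg_right ht ha) x)

lemma map_sup_zero_nonpos (h : IsAtomCoordinate a φ) (ha : 0 < a) {y : F} (hy : φ y ≤ 0) :
    φ (y ⊔ 0) ≤ 0 := by
  have h1 : φ (y ⊔ 0) - φ (-y ⊔ 0) = φ y := by
    rw [← map_sub, ← posPart_def, ← negPart_def, posPart_sub_negPart]
  refine nonpos_of_smul_nonpos ha ?_
  have h2 := posPart_inf_negPart_eq_zero y
  rw [posPart_def, negPart_def] at h2
  refine (le_inf (h.smul_le _ le_sup_right) ?_).trans h2.le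
  exact (smul_le_smul_of_nonneg_right (by linarith) ha.le).trans (h.smul_le _ le_sup_right)

lemma tendsto_of_orderConvergesTo (h : IsAtomCoordinate a φ) (ha : 0 < a) {G : Filter F} {p : F}
    (hG : OrderConvergesTo G p) : Filter.Tendsto φ G (nhds (φ p)) := by
  obtain ⟨S, -, hSG, hS⟩ := hG
  have hp : ∀ q ∈ S, p ∈ Set.Icc q.1 q.2 := fun q hq => by
    have : p ∈ ⋂ q ∈ S, Set.Icc q.1 q.2 := hS ▸ Set.mem_singleton p
    exact Set.mem_iInter₂.1 this q hq
  have huniq : ∀ t : ℝ, (∀ q ∈ S, p + t • a ∈ Set.Icc q.1 q.2) → t = 0 := fun t ht => by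
    have h1 : p + t • a ∈ ⋂ q ∈ S, Set.Icc q.1 q.2 := Set.mem_iInter₂.2 ht
    rw [hS, Set.mem_singleton_iff, add_eq_left] at h1
    rw [← h.map_smul_self t, h1, map_zero]
  refine tendsto_order.2 ⟨fun b hb => ?_, fun b hb => ?_⟩
  · obtain ⟨q, hq, hbq⟩ : ∃ q ∈ S, b < φ q.1 := by
      by_contra! hcon
      have := huniq (b - φ p) fun q hq => ⟨?_, ?_⟩
      · linarith
      · have h1 := h.smul_le _ (sub_nonneg.2 (hp q hq).1)
        have h2 : (φ p - b) • a ≤ φ (p - q.1) • a :=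
          smul_le_smul_of_nonneg_right (by rw [map_sub]; linarith [hcon q hq]) ha.le
        have h3 := le_sub_comm.1 (h2.trans h1)
        rwa [sub_eq_add_neg, ← neg_smul, neg_sub] at h3
      · exact (add_le_of_nonpos_right
          (smul_nonpos_of_nonpos_of_nonneg (by linarith) ha.le)).trans (hp q hq).2
    filter_upwards [hSG q hq] with x hx
    exact hbq.trans_le (h.mono hx.1)
  · obtain ⟨q, hq, hbq⟩ : ∃ q ∈ S, φ q.2 < b := by
      by_contra! hcon
      have := huniq (b - φ p) fun q hq => ⟨?_, ?_⟩
      · linarith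
      · exact (hp q hq).1.trans (le_add_of_nonneg_right (smul_nonneg (by linarith) ha.le))
      · have h1 := h.smul_le _ (sub_nonneg.2 (hp q hq).2)
        have h2 : (b - φ p) • a ≤ φ (q.2 - p) • a :=
          smul_le_smul_of_nonneg_right (by rw [map_sub]; linarith [hcon q hq]) ha.le
        rw [add_comm, ← le_sub_iff_add_le]
        exact h2.trans h1
    filter_upwards [hSG q hq] with x hx
    exact (h.mono hx.2).trans_lt hbq

end IsAtomCoordinate

variable [IsOrderedAddMonoid F] [IsOrderedModule ℝ F]

lemma IsVLAtom.exists_nonneg_coordinate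
    (harch : ∀ x y : F, (∀ n : ℕ, 0 ≤ n • x ∧ n • x ≤ y) → x = 0) {a : F} (ha : IsVLAtom a)
    {x : F} (hx : 0 ≤ x) : ∃ s : ℝ, 0 ≤ s ∧ s • a ≤ x ∧ (x - s • a) ⊓ a = 0 := by
  obtain ⟨s, hs0, hsx, hs⟩ := exists_max_smul_le harch ha.1 hx
  refine ⟨s, hs0, hsx, ?_⟩
  have hr : 0 ≤ (x - s • a) ⊓ a := le_inf (sub_nonneg.2 hsx) ha.1.le
  refine le_antisymm ?_ hr
  obtain ⟨t, ht⟩ := ha.2 _ hr inf_le_right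
  have h1 : t • a ≤ x - s • a := ht ▸ inf_le_left
  have h2 := hs (t + s) (by rw [add_smul]; exact le_sub_iff_add_le.1 h1)
  rw [ht]
  exact smul_nonpos_of_nonpos_of_nonneg (by linarith) ha.1.le

lemma le_of_sub_smul_inf_eq_zero {a x : F} (ha : 0 < a) {s t : ℝ}
    (hs : (x - s • a) ⊓ a = 0) (ht : t • a ≤ x) : t ≤ s := by
  by_contra! hst
  have h1 : (t - s) • a ≤ x - s • a := by
    rw [sub_smul]; exact sub_le_sub_right ht _
  have h2 : min (t - s) 1 • a ≤ 0 := by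
    rw [← hs]
    refine le_inf ((smul_le_smul_of_nonneg_right (min_le_left _ _) ha.le).trans h1) ?_
    simpa using smul_le_smul_of_nonneg_right (min_le_right (t - s) 1) ha.le
  have h3 := nonpos_of_smul_nonpos ha h2
  have h4 : 0 < min (t - s) 1 := lt_min (by linarith) one_pos
  linarith

lemma IsVLAtom.exists_isAtomCoordinate
    (harch : ∀ x y : F, (∀ n : ℕ, 0 ≤ n • x ∧ n • x ≤ y) → x = 0) {a : F} (ha : IsVLAtom a) :
    ∃ φ : F →+ ℝ, IsAtomCoordinate a φ := by
  have hex : ∀ x : F, ∃ s : ℝ, 0 ≤ x → 0 ≤ s ∧ s • a ≤ x ∧ (x - s • a) ⊓ a = 0 := fun x => by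
    by_cases hx : 0 ≤ x
    · obtain ⟨s, hs⟩ := ha.exists_nonneg_coordinate harch hx
      exact ⟨s, fun _ => hs⟩
    · exact ⟨0, fun h => absurd h hx⟩
  choose c hc using hex
  have huniq : ∀ (x : F) (s : ℝ), 0 ≤ x → s • a ≤ x → (x - s • a) ⊓ a = 0 → c x = s :=
    fun x s hx h1 h2 => le_antisymm (le_of_sub_smul_inf_eq_zero ha.1 h2 (hc x hx).2.1)
      (le_of_sub_smul_inf_eq_zero ha.1 (hc x hx).2.2 h1)
  have hadd : ∀ x y : F, 0 ≤ x → 0 ≤ y → c (x + y) = c x + c y := fun x y hx hy => by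
    refine huniq _ _ (add_nonneg hx hy) ?_ ?_
    · rw [add_smul]
      exact add_le_add (hc x hx).2.1 (hc y hy).2.1
    · rw [add_smul, add_sub_add_comm]
      exact add_inf_eq_zero_of_nonneg (sub_nonneg.2 (hc x hx).2.1) (sub_nonneg.2 (hc y hy).2.1)
        ha.1.le (hc x hx).2.2 (hc y hy).2.2
  have hsub : ∀ x y z w : F, 0 ≤ x → 0 ≤ y → 0 ≤ z → 0 ≤ w → x - y = z - w →
      c x - c y = c z - c w := fun x y z w hx hy hz hw h => by
    have h1 := hadd x w hx hw
    rw [sub_eq_sub_iff_add_eq_add.1 h, hadd z y hz hy] at h1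
    linarith
  have hdiff : ∀ x y : F, 0 ≤ x → 0 ≤ y → c ((x - y)⁺) - c ((x - y)⁻) = c x - c y :=
    fun x y hx hy => hsub _ _ _ _ (posPart_nonneg _) (negPart_nonneg _) hx hy
      (posPart_sub_negPart _)
  have hc0 : c 0 = 0 := by simpa using hadd 0 0 le_rfl le_rfl
  let φ : F →+ ℝ := AddMonoidHom.mk' (fun x => c x⁺ - c x⁻) fun x y => by
    have h1 := hdiff (x⁺ + y⁺) (x⁻ + y⁻) (add_nonneg (posPart_nonneg _) (posPart_nonneg _))
      (add_nonneg (negPart_nonneg _) (negPart_nonneg _))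
    rw [add_sub_add_comm, posPart_sub_negPart, posPart_sub_negPart,
      hadd _ _ (posPart_nonneg _) (posPart_nonneg _),
      hadd _ _ (negPart_nonneg _) (negPart_nonneg _)] at h1
    rw [h1]
    ring
  have hφ : ∀ x : F, 0 ≤ x → φ x = c x := fun x hx => by
    have h1 : φ (x - 0) = c x - c 0 := by
      rw [← hdiff x 0 hx le_rfl, sub_zero]
      rfl
    rwa [hc0, sub_zero, sub_zero] at h1
  have hsmul : ∀ r : ℝ, 0 ≤ r → φ (r • a) = r := fun r hr => by
    have hra := smul_nonneg hr ha.1.le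
    rw [hφ _ hra]
    exact huniq _ _ hra le_rfl (by simpa using ha.1.le)
  refine ⟨φ, fun r => ?_, fun x hx => ?_, fun x hx => ?_⟩
  · rcases le_total 0 r with hr | hr
    · exact hsmul r hr
    · have := hsmul (-r) (neg_nonneg.2 hr)
      rw [neg_smul, map_neg] at this
      linarith
  · rw [hφ x hx]; exact (hc x hx).1
  · rw [hφ x hx]; exact (hc x hx).2.1

lemma nonpos_of_forall_atomCoordinate_nonpos
    (hatomic : ∀ g : F, 0 < g → ∃ a : F, IsVLAtom a ∧ a ≤ g)
    {φ : {a : F // IsVLAtom a} → F →+ ℝ} (hφ : ∀ a, IsAtomCoordinate a.1 (φ a)) {z : F}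
    (hz : ∀ a, φ a z ≤ 0) : z ≤ 0 := by
  by_contra hz0
  have hpos := sup_zero_pos_of_not_le hz0
  rw [sub_zero] at hpos
  obtain ⟨a, ha, haz⟩ := hatomic _ hpos
  have h1 := (hφ ⟨a, ha⟩).mono haz
  have h2 := (hφ ⟨a, ha⟩).map_sup_zero_nonpos ha.1 (hz ⟨a, ha⟩)
  rw [(hφ ⟨a, ha⟩).map_self] at h1
  linarith

lemma eq_of_forall_atomCoordinate_eq
    (hatomic : ∀ g : F, 0 < g → ∃ a : F, IsVLAtom a ∧ a ≤ g)
    {φ : {a : F // IsVLAtom a} → F →+ ℝ} (hφ : ∀ a, IsAtomCoordinate a.1 (φ a)) {x y : F}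
    (hxy : ∀ a, φ a x = φ a y) : x = y := by
  refine le_antisymm ?_ ?_ <;> rw [← sub_nonpos] <;>
    refine nonpos_of_forall_atomCoordinate_nonpos hatomic hφ fun a => ?_ <;>
    rw [map_sub, hxy, sub_self]

lemma orderConvergesTo_of_tendsto_atomCoordinate
    (hatomic : ∀ g : F, 0 < g → ∃ a : F, IsVLAtom a ∧ a ≤ g)
    {φ : {a : F // IsVLAtom a} → F →+ ℝ} (hφ : ∀ a, IsAtomCoordinate a.1 (φ a)) {u v p : F}
    (hp : p ∈ Set.Icc u v) {G : Filter F} (hG : Set.Icc u v ∈ G)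
    (h : ∀ a, Filter.Tendsto (φ a) G (nhds (φ a p))) : OrderConvergesTo G p := by
  have hmem : ∀ (a : {a : F // IsVLAtom a}) (ε : ℝ) (x : F), x ∈ Set.Icc u v →
      φ a p - ε ≤ φ a x → φ a x ≤ φ a p + ε →
      x ∈ Set.Icc (u - φ a u • a.1 + (φ a p - ε) • a.1) (v - φ a v • a.1 + (φ a p + ε) • a.1) :=
    fun a ε x hx h1 h2 =>
      ⟨(hφ a).add_smul_le a.2.1.le hx.1 h1, (hφ a).le_add_smul a.2.1.le hx.2 h2⟩
  have hpmem := fun (a : {a : F // IsVLAtom a}) (ε : ℝ) (hε : 0 < ε) =>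
    hmem a ε p hp (by linarith) (by linarith)
  refine ⟨{q | ∃ (a : {a : F // IsVLAtom a}) (ε : ℝ), 0 < ε ∧
    q = (u - φ a u • a.1 + (φ a p - ε) • a.1, v - φ a v • a.1 + (φ a p + ε) • a.1)}, ?_, ?_, ?_⟩
  · rintro _ ⟨a, ε, hε, rfl⟩
    exact (hpmem a ε hε).1.trans (hpmem a ε hε).2
  · rintro _ ⟨a, ε, hε, rfl⟩
    filter_upwards [hG, (h a).eventually (Ioo_mem_nhds (sub_lt_self (φ a p) hε)
      (lt_add_of_pos_right (φ a p) hε))] with x hx hx'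
    exact hmem a ε x hx hx'.1.le hx'.2.le
  · ext z
    simp only [Set.mem_iInter, Set.mem_singleton_iff]
    constructor
    · refine fun hz => eq_of_forall_atomCoordinate_eq hatomic hφ fun a => ?_
      refine le_antisymm (le_of_forall_pos_le_add fun ε hε => ?_)
        (le_of_forall_pos_le_add fun ε hε => ?_)
      · have := (hφ a).mono (hz _ ⟨a, ε, hε, rfl⟩).2
        rwa [(hφ a).map_sub_smul_add] at this
      · have := (hφ a).mono (hz _ ⟨a, ε, hε, rfl⟩).1
        rw [(hφ a).map_sub_smul_add] at this
        linarith
    · rintro rfl _ ⟨a, ε, hε, rfl⟩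
      exact hpmem a ε hε

lemma orderPreCompact_Icc_of_atomic_s13
    (hatomic : ∀ g : F, 0 < g → ∃ a : F, IsVLAtom a ∧ a ≤ g)
    {φ : {a : F // IsVLAtom a} → F →+ ℝ} (hφ : ∀ a, IsAtomCoordinate a.1 (φ a)) {u v : F}
    (huv : u ≤ v) : OrderPreCompact (Set.Icc u v) := by
  intro U hU
  have hlim : ∀ a, ∃ r, Filter.Tendsto (φ a) U (nhds r) := fun a => by
    obtain ⟨r, -, hr⟩ := (isCompact_Icc (a := φ a u) (b := φ a v)).ultrafilter_le_nhds (U.map (φ a))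
      (Filter.le_principal_iff.2 (Ultrafilter.mem_map.2 (Filter.mem_of_superset hU fun x hx =>
        ⟨(hφ a).mono hx.1, (hφ a).mono hx.2⟩)))
    exact ⟨r, hr⟩
  have hw : (0 : F) ∈ Set.Icc (u - v) (v - u) := ⟨sub_nonpos.2 huv, sub_nonneg.2 huv⟩
  refine orderConvergesTo_of_tendsto_atomCoordinate hatomic hφ hw ?_ fun a => ?_
  · refine Filter.mem_map.2 (Filter.mem_of_superset (Filter.prod_mem_prod hU hU) ?_)
    rintro ⟨x, y⟩ ⟨hx, hy⟩
    exact ⟨sub_le_sub hx.1 hy.2, sub_le_sub hx.2 hy.1⟩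
  · obtain ⟨r, hr⟩ := hlim a
    rw [Filter.tendsto_map'_iff]
    have := (hr.comp Filter.tendsto_fst).sub (hr.comp (Filter.tendsto_snd (f := (U : Filter F))))
    rw [sub_self] at this
    rw [map_zero]
    convert this using 1
    ext q
    simp

lemma exists_topology_Icc_of_atomic
    (hatomic : ∀ g : F, 0 < g → ∃ a : F, IsVLAtom a ∧ a ≤ g)
    {φ : {a : F // IsVLAtom a} → F →+ ℝ} (hφ : ∀ a, IsAtomCoordinate a.1 (φ a)) (u v : F) :
    ∃ τ : TopologicalSpace (Set.Icc u v), ∀ G : Filter F, Set.Icc u v ∈ G → ∀ p : Set.Icc u v,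
      (OrderConvergesTo G (p : F) ↔
        Filter.comap (Subtype.val : Set.Icc u v → F) G ≤ @nhds _ τ p) := by
  refine ⟨TopologicalSpace.induced (fun x a => φ a x.1) inferInstance, fun G hG p => ?_⟩
  rw [nhds_induced, ← Filter.tendsto_iff_comap, tendsto_pi_nhds]
  have hcomap : ∀ a, Filter.Tendsto (fun x : Set.Icc u v => φ a x.1)
      (Filter.comap Subtype.val G) (nhds (φ a p)) ↔ Filter.Tendsto (φ a) G (nhds (φ a p)) :=
    fun a => by
      have hmap : Filter.map (Subtype.val : Set.Icc u v → F) (Filter.comap Subtype.val G) = G :=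
        Filter.map_comap_of_mem (by rwa [Subtype.range_coe])
      conv_rhs => rw [← hmap]
      rw [Filter.tendsto_map'_iff]
      rfl
  simp only [hcomap]
  exact ⟨fun h a => (hφ a).tendsto_of_orderConvergesTo a.2.1 h,
    orderConvergesTo_of_tendsto_atomCoordinate hatomic hφ p.2 hG⟩

end AtomCoordinate

section Atomless

variable {F : Type*} [Lattice F] [AddCommGroup F] [Module ℝ F] [IsOrderedAddMonoid F]
  [IsOrderedModule ℝ F]

/-- Below a positive element dominating no atom, an order interval is not covered by finitely
many sets whose difference sets have upper bounds not dominating that element. -/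
lemma exists_mem_Icc_forall_notMem
    (harch : ∀ x y : F, (∀ n : ℕ, 0 ≤ n • x ∧ n • x ≤ y) → x = 0) {g : F} (hg : 0 < g)
    (hna : ∀ a : F, a ≤ g → ¬ IsVLAtom a) {ι : Type*} (s : Finset ι) (A : ι → Set F)
    (hA : ∀ i ∈ s, ∃ c : F, 0 ≤ c ∧ ¬ g ≤ c ∧ ∀ x ∈ A i, ∀ y ∈ A i, x - y ≤ c) :
    ∃ x ∈ Set.Icc 0 g, ∀ i ∈ s, x ∉ A i := by
  classical
  have hA' : ∀ i, ∃ c : F, i ∈ s → 0 ≤ c ∧ ¬ g ≤ c ∧ ∀ x ∈ A i, ∀ y ∈ A i, x - y ≤ c := fun i => by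
    by_cases hi : i ∈ s
    · obtain ⟨c, hc⟩ := hA i hi
      exact ⟨c, fun _ => hc⟩
    · exact ⟨0, fun h => absurd h hi⟩
  choose c hc using hA'
  obtain ⟨d, hd, hdd⟩ := exists_pairwise_disjoint_le_s13 harch hna s (fun i => (g - c i) ⊔ 0)
    fun i hi => ⟨sup_zero_pos_of_not_le (hc i hi).2.1, sup_le (sub_le_self _ (hc i hi).1) hg.le⟩
  have hn : ∀ i, ∃ n : ℕ, i ∈ s → 0 < (n • d i - g) ⊔ 0 := fun i => by
    by_cases hi : i ∈ s
    · obtain ⟨n, hn⟩ := exists_nsmul_sub_sup_zero_pos harch (hd i hi).1 g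
      exact ⟨n, fun _ => hn⟩
    · exact ⟨0, fun h => absurd h hi⟩
  choose n hn using hn
  set e : ι → F := fun i => (n i • d i - g) ⊔ 0 with he
  set I := {i ∈ s | ∃ z ∈ A i, 0 ≤ z ∧ z ⊓ e i = 0} with hI
  have hIs : ∀ i ∈ I, i ∈ s := fun i hi => (Finset.mem_filter.1 hi).1
  have hD0 : ∀ i ∈ I, 0 ≤ n i • d i := fun i hi => nsmul_nonneg (hd i (hIs i hi)).1.le _
  set D := ∑ i ∈ I, n i • d i with hD
  have hDnonneg : 0 ≤ D := Finset.sum_nonneg hD0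
  have hx : g ⊓ D ∈ Set.Icc 0 g := ⟨le_inf hg.le hDnonneg, inf_le_left⟩
  refine ⟨g ⊓ D, hx, fun i hi hxA => ?_⟩
  by_cases hiI : i ∈ I
  · obtain ⟨-, z, hzA, hz0, hze⟩ := Finset.mem_filter.1 hiI
    have h1 : (g - g ⊓ D) ⊓ e i = 0 :=
      sub_inf_inf_sub_sup_zero (Finset.single_le_sum hD0 hiI)
    have h2 : ((g - g ⊓ D) + z) ⊓ e i = 0 :=
      add_inf_eq_zero_of_nonneg (sub_nonneg.2 inf_le_left) hz0 (hn i hi).le h1 hze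
    refine inf_nsmul_sub_sup_zero_ne_zero (hd i hi).1.le (hd i hi).2 hg.le (hn i hi) ?_
    refine inf_eq_zero_of_le_s13 le_sup_right (hn i hi).le ?_ le_rfl h2
    refine sup_le ?_ (add_nonneg (sub_nonneg.2 inf_le_left) hz0)
    have h3 := sub_le_sub_left ((hc i hi).2.2 _ hxA _ hzA) g
    rwa [sub_sub_eq_add_sub, add_sub_right_comm] at h3
  · refine hiI (Finset.mem_filter.2 ⟨hi, g ⊓ D, hxA, hx.1, ?_⟩)
    have h1 : D ⊓ (n i • d i) = 0 := by
      refine sum_inf_eq_zero I _ (nsmul_nonneg (hd i hi).1.le _) hD0 fun j hj => ?_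
      have hdj := (hd j (hIs j hj)).1.le
      refine nsmul_inf_eq_zero hdj (nsmul_nonneg (hd i hi).1.le _) ?_ _
      rw [inf_comm]
      refine nsmul_inf_eq_zero (hd i hi).1.le hdj (hdd i hi j (hIs j hj) ?_) _
      rintro rfl
      exact hiI hj
    exact inf_eq_zero_of_le_s13 hx.1 (hn i hi).le inf_le_right
      (sup_le (sub_le_self _ hg.le) (nsmul_nonneg (hd i hi).1.le _)) h1

lemma not_orderPreCompact_Icc
    (harch : ∀ x y : F, (∀ n : ℕ, 0 ≤ n • x ∧ n • x ≤ y) → x = 0) {g : F} (hg : 0 < g)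
    (hna : ∀ a : F, a ≤ g → ¬ IsVLAtom a) : ¬ OrderPreCompact (Set.Icc 0 g) := by
  classical
  intro hpre
  set small : Set F → Prop := fun A =>
    ∃ c : F, 0 ≤ c ∧ ¬ g ≤ c ∧ ∀ x ∈ A, ∀ y ∈ A, x - y ≤ c
  set s : Set (Set F) := {B | small (Set.Icc 0 g \ B)} with hs
  have hne : (Filter.generate s).NeBot := by
    rw [Filter.generate_neBot_iff]
    intro t hts htf
    obtain ⟨x, hx, hxt⟩ := exists_mem_Icc_forall_notMem harch hg hna htf.toFinset
      (fun B => Set.Icc 0 g \ B) fun B hB => hts (htf.mem_toFinset.1 hB)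
    refine ⟨x, fun B hB => ?_⟩
    by_contra hxB
    exact hxt B (htf.mem_toFinset.2 hB) ⟨hx, hxB⟩
  have hU : ∀ B ∈ s, B ∈ Ultrafilter.of (Filter.generate s) := fun B hB =>
    Ultrafilter.of_le _ (Filter.mem_generate_of_mem hB)
  obtain ⟨S, -, hSU, hS⟩ := hpre (Ultrafilter.of (Filter.generate s))
    (hU _ ⟨0, le_rfl, hg.not_ge, by simp⟩)
  have hgS : g ∉ ⋂ q ∈ S, Set.Icc q.1 q.2 := by
    rw [hS]; exact hg.ne'
  have h0S : (0 : F) ∈ ⋂ q ∈ S, Set.Icc q.1 q.2 := by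
    rw [hS]; exact rfl
  simp only [Set.mem_iInter, not_forall] at hgS h0S
  obtain ⟨q, hq, hgq⟩ := hgS
  have h0q := h0S q hq
  have hgc : ¬ g ≤ q.2 := fun h => hgq ⟨h0q.1.trans hg.le, h⟩
  obtain ⟨A, hAU, hA⟩ := Filter.mem_prod_self_iff.1 (Filter.mem_map.1 (hSU q hq))
  have hAs : Aᶜ ∈ s := by
    refine ⟨q.2, h0q.2, hgc, fun x hx y hy => ?_⟩
    have hxA : x ∈ A := not_not.1 hx.2
    have hyA : y ∈ A := not_not.1 hy.2
    exact (hA (Set.mk_mem_prod hxA hyA)).2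
  exact Ultrafilter.compl_notMem_iff.2 hAU (hU _ hAs)

lemma not_exists_topology_Icc
    (harch : ∀ x y : F, (∀ n : ℕ, 0 ≤ n • x ∧ n • x ≤ y) → x = 0) {g : F} (hg : 0 < g)
    (hna : ∀ a : F, a ≤ g → ¬ IsVLAtom a) :
    ¬ ∃ τ : TopologicalSpace (Set.Icc 0 g), ∀ G : Filter F, Set.Icc 0 g ∈ G →
      ∀ p : Set.Icc 0 g, (OrderConvergesTo G (p : F) ↔
        Filter.comap (Subtype.val : Set.Icc 0 g → F) G ≤ @nhds _ τ p) := by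
  rintro ⟨τ, hτ⟩
  set o : Set.Icc 0 g := ⟨0, le_rfl, hg.le⟩ with ho
  set N : Filter F := Filter.map Subtype.val (@nhds _ τ o) with hN
  have hcomap : Filter.comap (Subtype.val : Set.Icc 0 g → F) N = @nhds _ τ o :=
    Filter.comap_map Subtype.val_injective
  obtain ⟨S, -, hSN, hS⟩ := (hτ N (Filter.mem_map.2 (by simp)) o).2 hcomap.le
  have hgS : g ∉ ⋂ q ∈ S, Set.Icc q.1 q.2 := by
    rw [hS]; exact hg.ne'
  have h0S : (0 : F) ∈ ⋂ q ∈ S, Set.Icc q.1 q.2 := by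
    rw [hS]; exact rfl
  simp only [Set.mem_iInter, not_forall] at hgS h0S
  obtain ⟨q, hq, hgq⟩ := hgS
  have h0q := h0S q hq
  have hgc : ¬ g ≤ q.2 := fun h => hgq ⟨h0q.1.trans hg.le, h⟩
  have hfg : (g - q.2) ⊔ 0 ≤ g := sup_le (sub_le_self _ h0q.2) hg.le
  obtain ⟨d, hd, hdd⟩ := exists_disjoint_seq_le harch (sup_zero_pos_of_not_le hgc)
    fun a ha => hna a (ha.trans hfg)
  choose n hn using fun m => exists_nsmul_sub_sup_zero_pos harch (hd m).1 g
  have hnd : ∀ m, 0 ≤ n m • d m := fun m => nsmul_nonneg (hd m).1.le _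
  have hx : ∀ m, 0 ≤ g ⊓ n m • d m ∧ g ⊓ n m • d m ≤ g := fun m =>
    ⟨le_inf hg.le (hnd m), inf_le_left⟩
  have hconv : OrderConvergesTo (Filter.map (fun m => g ⊓ n m • d m) Filter.atTop) (0 : F) := by
    refine orderConvergesTo_zero_of_disjoint_seq harch hx fun k m hkm => ?_
    refine inf_eq_zero_of_le_s13 (hx k).1 (hx m).1 inf_le_right inf_le_right ?_
    refine nsmul_inf_eq_zero (hd k).1.le (hnd m) ?_ _
    rw [inf_comm]
    refine nsmul_inf_eq_zero (hd m).1.le (hd k).1.le ?_ _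
    rw [inf_comm]
    exact hdd k m hkm
  have hle := (hτ _ (Filter.mem_map.2 (Filter.univ_mem' hx)) o).1 hconv
  obtain ⟨t, ht, htq⟩ := Filter.mem_comap.1 (hle (Filter.mem_map.1 (hSN q hq)))
  obtain ⟨m, hm⟩ := Filter.nonempty_of_mem (Filter.mem_map.1 ht)
  have hmq : g ⊓ n m • d m ≤ q.2 :=
    (htq (show (⟨_, hx m⟩ : Set.Icc 0 g) ∈ Subtype.val ⁻¹' t from hm)).2
  refine inf_nsmul_sub_sup_zero_ne_zero (hd m).1.le (hd m).2 hg.le (hn m) ?_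
  refine inf_eq_zero_of_le_s13 le_sup_right (hn m).le ?_ le_rfl (sub_inf_inf_sub_sup_zero le_rfl)
  exact sup_le (sub_le_sub_left hmq g) (sub_nonneg.2 inf_le_left)

end Atomless

/-- An Archimedean vector lattice is atomic iff every order interval is
order pre-compact iff order convergence on every order interval is topological. -/
theorem atomic_iff_intervals_orderPreCompact_iff_intervals_topological
    {F : Type*} [Lattice F] [AddCommGroup F] [Module ℝ F]
    (hadd : ∀ x y z : F, x ≤ y → x + z ≤ y + z)
    (hsmul : ∀ (t : ℝ) (x : F), 0 ≤ t → 0 ≤ x → 0 ≤ t • x)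
    (harch : ∀ x y : F, (∀ n : ℕ, 0 ≤ n • x ∧ n • x ≤ y) → x = 0) :
    List.TFAE
      [∀ g : F, 0 < g → ∃ a : F, IsVLAtom a ∧ a ≤ g,
       ∀ u v : F, u ≤ v → OrderPreCompact (Set.Icc u v),
       ∀ u v : F, u ≤ v →
         ∃ τ : TopologicalSpace (Set.Icc u v),
           ∀ G : Filter F, Set.Icc u v ∈ G →
             ∀ p : Set.Icc u v,
               (OrderConvergesTo G (p : F) ↔
                 Filter.comap (Subtype.val : Set.Icc u v → F) G ≤ @nhds _ τ p)] := by
  have : IsOrderedAddMonoid F := ⟨fun a b h c => hadd a b c h, fun a b h c => by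
    simpa only [add_comm c] using hadd a b c h⟩
  have : IsOrderedModule ℝ F := .of_smul_nonneg fun t ht x hx => hsmul t x ht hx
  choose φ hφ using fun a : {a : F // IsVLAtom a} => a.2.exists_isAtomCoordinate harch
  tfae_have 1 → 2 := fun h u v huv => orderPreCompact_Icc_of_atomic_s13 h hφ huv
  tfae_have 1 → 3 := fun h u v _ => exists_topology_Icc_of_atomic h hφ u v
  tfae_have 2 → 1 := fun h g hg => by
    by_contra! hna
    exact not_orderPreCompact_Icc harch hg (fun a hag ha => hna a ha hag) (h 0 g hg.le)
  tfae_have 3 → 1 := fun h g hg => by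
    by_contra! hna
    exact not_exists_topology_Icc harch hg (fun a hag ha => hna a ha hag) (h 0 g hg.le)
  tfae_finish
end
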